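/- For every α > 0 with α ≠ 1, the Tsallis entropy of the Poisson distribution, λ ↦ H_T(α,λ), is strictly increasing on (0,∞). -/

import Mathlib

open Real Filter Topology

/-- The Poisson probabilities `p_i(λ) = e^{-λ} λ^i / i!`. -/
noncomputable def poissonP (l : ℝ) (i : ℕ) : ℝ :=
  Real.exp (-l) * l ^ i / (Nat.factorial i)

/-- `ψ(α,λ) = ∑_{i=0}^∞ (p_i(λ))^α`. -/
noncomputable def psiPoisson (α l : ℝ) : ℝ :=
  ∑' i, (poissonP l i) ^ α

theorem poissonP_pos {l : ℝ} (hl : 0 < l) (i : ℕ) : 0 < poissonP l i := by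
  unfold poissonP
  positivity

theorem poissonP_succ (l : ℝ) (i : ℕ) :
    poissonP l (i + 1) = l / (i + 1) * poissonP l i := by
  unfold poissonP
  rw [Nat.factorial_succ]
  push_cast
  field_simp
  ring

theorem hasSum_poissonP (l : ℝ) : HasSum (poissonP l) 1 := by
  have h : HasSum (fun i : ℕ => l ^ i / (Nat.factorial i : ℝ)) (Real.exp l) := by
    rw [Real.exp_eq_exp_ℝ]
    exact NormedSpace.expSeries_div_hasSum_exp l
  have h' := h.mul_left (Real.exp (-l))
  rw [← Real.exp_add, neg_add_cancel, Real.exp_zero] at h'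
  refine (funext fun i => ?_ : poissonP l = _) ▸ h'
  exact mul_div_assoc _ _ _

/-- The convolution of two Poisson distributions is a Poisson distribution. -/
theorem poissonP_add (a b : ℝ) (n : ℕ) :
    poissonP (a + b) n =
      ∑ m ∈ Finset.HasAntidiagonal.antidiagonal n, poissonP a m.1 * poissonP b m.2 := by
  simp only [poissonP]
  rw [(Commute.all a b).add_pow', Finset.mul_sum, Finset.sum_div]
  refine Finset.sum_congr rfl fun m hm => ?_
  obtain rfl := Finset.HasAntidiagonal.mem_antidiagonal.mp hm
  have h : ((m.1 + m.2).choose m.1 : ℝ) * (Nat.factorial m.1) * (Nat.factorial m.2)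
      = Nat.factorial (m.1 + m.2) := by
    rw [Nat.choose_symm_add]
    exact_mod_cast Nat.add_choose_mul_factorial_mul_factorial m.1 m.2
  have h' : Real.exp (-(a + b)) = Real.exp (-a) * Real.exp (-b) := by
    rw [← Real.exp_add, neg_add]
  rw [h', nsmul_eq_mul]
  field_simp
  rw [← h]
  ring

theorem summable_poissonP_rpow {α l : ℝ} (hα : 0 < α) (hl : 0 < l) :
    Summable fun i => poissonP l i ^ α := by
  refine summable_of_ratio_test_tendsto_lt_one zero_lt_one
    (.of_forall fun i => (rpow_pos_of_pos (poissonP_pos hl i) α).ne') ?_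
  have h : Tendsto (fun i : ℕ => (l / ((i : ℝ) + 1)) ^ α) atTop (𝓝 0) := by
    have h0 : Tendsto (fun i : ℕ => l / ((i : ℝ) + 1)) atTop (𝓝 0) :=
      tendsto_const_nhds.div_atTop
        (tendsto_atTop_add_const_right _ _ tendsto_natCast_atTop_atTop)
    simpa [Real.zero_rpow hα.ne'] using h0.rpow_const (Or.inr hα.le)
  refine h.congr fun i => ?_
  have hp := poissonP_pos hl i
  rw [poissonP_succ, Real.mul_rpow (by positivity) hp.le, norm_mul,
    mul_div_cancel_right₀ _ (norm_ne_zero_iff.mpr (rpow_pos_of_pos hp α).ne'), Real.norm_of_nonneg (by positivity)]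

theorem hasSum_poissonP_mul_rpow {α l : ℝ} (hα : 0 < α) (hl : 0 < l) (d : ℝ) :
    HasSum (fun n => ∑ m ∈ Finset.HasAntidiagonal.antidiagonal n, poissonP d m.1 * poissonP l m.2 ^ α)
      (psiPoisson α l) := by
  have hq : Summable fun i => ‖poissonP d i‖ := (hasSum_poissonP d).summable.norm
  have hp : Summable fun i => ‖poissonP l i ^ α‖ := (summable_poissonP_rpow hα hl).norm
  have h := tsum_mul_tsum_eq_tsum_sum_antidiagonal_of_summable_norm hq hp
  rw [(hasSum_poissonP d).tsum_eq, one_mul] at h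
  rw [psiPoisson, h]
  exact (summable_norm_sum_mul_antidiagonal_of_summable_norm hq hp).of_norm.hasSum

theorem sum_antidiagonal_poissonP_le_one {d : ℝ} (hd : 0 < d) (n : ℕ) :
    ∑ m ∈ Finset.HasAntidiagonal.antidiagonal n, poissonP d m.1 ≤ 1 := by
  rw [Finset.Nat.sum_antidiagonal_eq_sum_range_succ_mk]
  exact sum_le_hasSum _ (fun i _ => (poissonP_pos hd i).le) (hasSum_poissonP d)

theorem poissonP_zero_lt_one {d : ℝ} (hd : 0 < d) : poissonP d 0 < 1 := by
  simpa [poissonP] using hd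

theorem rpow_sum_le_sum_mul_rpow {ι : Type*} {s : Finset ι} {w x : ι → ℝ} {α : ℝ}
    (hα : 1 < α) (hw : ∀ i ∈ s, 0 ≤ w i) (hw1 : ∑ i ∈ s, w i ≤ 1)
    (hx : ∀ i ∈ s, 0 ≤ x i) :
    (∑ i ∈ s, w i * x i) ^ α ≤ ∑ i ∈ s, w i * x i ^ α := by
  simpa [Real.zero_rpow (zero_lt_one.trans hα).ne'] using
    (convexOn_rpow hα.le).map_add_sum_le hw (sub_add_cancel 1 (∑ i ∈ s, w i)) hx
      (sub_nonneg.mpr hw1) (Set.self_mem_Ici (a := (0 : ℝ)))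

theorem sum_mul_rpow_le_rpow_sum {ι : Type*} {s : Finset ι} {w x : ι → ℝ} {α : ℝ}
    (hα : 0 < α) (hα1 : α < 1) (hw : ∀ i ∈ s, 0 ≤ w i) (hw1 : ∑ i ∈ s, w i ≤ 1)
    (hx : ∀ i ∈ s, 0 ≤ x i) :
    ∑ i ∈ s, w i * x i ^ α ≤ (∑ i ∈ s, w i * x i) ^ α := by
  simpa [Real.zero_rpow hα.ne'] using
    (concaveOn_rpow hα.le hα1.le).map_add_sum_le hw (sub_add_cancel 1 (∑ i ∈ s, w i)) hx
      (sub_nonneg.mpr hw1) (Set.self_mem_Ici (a := (0 : ℝ)))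

theorem psiPoisson_add_lt {α d l : ℝ} (hα : 1 < α) (hd : 0 < d) (hl : 0 < l) :
    psiPoisson α (d + l) < psiPoisson α l := by
  have hα0 : 0 < α := zero_lt_one.trans hα
  refine hasSum_lt (i := 0) (fun n => ?_) ?_
    (summable_poissonP_rpow hα0 (add_pos hd hl)).hasSum (hasSum_poissonP_mul_rpow hα0 hl d)
  · dsimp only
    rw [poissonP_add]
    exact rpow_sum_le_sum_mul_rpow hα (fun m _ => (poissonP_pos hd _).le)
      (sum_antidiagonal_poissonP_le_one hd n) (fun m _ => (poissonP_pos hl _).le)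
  · have hq := poissonP_pos hd 0
    have hp := poissonP_pos hl 0
    simp only [poissonP_add, Finset.Nat.antidiagonal_zero, Finset.sum_singleton]
    rw [Real.mul_rpow hq.le hp.le]
    gcongr
    exact rpow_lt_self_of_lt_one hq (poissonP_zero_lt_one hd) hα

theorem psiPoisson_lt_add {α d l : ℝ} (hα : 0 < α) (hα1 : α < 1) (hd : 0 < d)
    (hl : 0 < l) : psiPoisson α l < psiPoisson α (d + l) := by
  refine hasSum_lt (i := 0) (fun n => ?_) ?_ (hasSum_poissonP_mul_rpow hα hl d)
    (summable_poissonP_rpow hα (add_pos hd hl)).hasSum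
  · dsimp only
    rw [poissonP_add]
    exact sum_mul_rpow_le_rpow_sum hα hα1 (fun m _ => (poissonP_pos hd _).le)
      (sum_antidiagonal_poissonP_le_one hd n) (fun m _ => (poissonP_pos hl _).le)
  · have hq := poissonP_pos hd 0
    have hp := poissonP_pos hl 0
    simp only [poissonP_add, Finset.Nat.antidiagonal_zero, Finset.sum_singleton]
    rw [Real.mul_rpow hq.le hp.le]
    gcongr
    exact self_lt_rpow_of_lt_one hq (poissonP_zero_lt_one hd) hα1

/-- the Tsallis entropy of the Poisson distribution is strictly
increasing in λ. -/
theorem tsallis_poisson_strictMono (α : ℝ) (hα : 0 < α) (hα1 : α ≠ 1) :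
    StrictMonoOn (fun l : ℝ => (1 - α)⁻¹ * (psiPoisson α l - 1))
      (Set.Ioi (0 : ℝ)) := by
  intro a ha b _ hab
  have hd : 0 < b - a := sub_pos.mpr hab
  rcases hα1.lt_or_gt with h | h
  · have hlt := psiPoisson_lt_add hα h hd ha
    rw [sub_add_cancel] at hlt
    exact mul_lt_mul_of_pos_left (sub_lt_sub_right hlt 1) (inv_pos.mpr (sub_pos.mpr h))
  · have hlt := psiPoisson_add_lt h hd ha
    rw [sub_add_cancel] at hlt
    exact mul_lt_mul_of_neg_left (sub_lt_sub_right hlt 1) (inv_lt_zero.mpr (sub_neg.mpr h))
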